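/- Let θ = (√5−1)/2 and let s = (s_i)_{i ≥ 0} be the characteristic Sturmian sequence s_i = ⌊(i+2)θ⌋ − ⌊(i+1)θ⌋. Let n ≥ 2 be an integer and set r = L_{2n}, a = F_{2n−1} − 1, b = L_{2n} − 1. Then s_{rk+a} = s_{rk+b} for all integers k with 0 ≤ k ≤ F_{4n+1} − F_{2n+1} − 2, but s_{rk+a} = 0 and s_{rk+b} = 1 for k = F_{4n+1} − F_{2n+1} − 1. -/

import Mathlib

/-- The Lucas numbers: `L_0 = 2`, `L_1 = 1`, `L_n = L_{n-1} + L_{n-2}`. -/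
def lucas : ℕ → ℕ
  | 0 => 2
  | 1 => 1
  | n + 2 => lucas (n + 1) + lucas n

/-- The characteristic Sturmian sequence of slope `θ`: `s_i = ⌊(i+2)θ⌋ - ⌊(i+1)θ⌋`. -/
noncomputable def sturmian (θ : ℝ) (i : ℕ) : ℤ :=
  ⌊((i : ℝ) + 2) * θ⌋ - ⌊((i : ℝ) + 1) * θ⌋

theorem lucas_succ_eq_fib_add_fib : ∀ m : ℕ, lucas (m + 1) = Nat.fib m + Nat.fib (m + 2)
  | 0 => rfl
  | 1 => rfl
  | m + 2 => by
    have h₁ := lucas_succ_eq_fib_add_fib m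
    have h₂ := lucas_succ_eq_fib_add_fib (m + 1)
    have h₃ := Nat.fib_add_two (n := m)
    have h₄ := Nat.fib_add_two (n := m + 2)
    have h₅ := Nat.fib_add_two (n := m + 1)
    have h₆ : lucas (m + 2 + 1) = lucas (m + 1 + 1) + lucas (m + 1) := rfl
    simp only [add_assoc, Nat.reduceAdd] at *
    omega

theorem neg_pow_succ_eq_fib_sub_fib_mul {θ : ℝ} (hθ : θ ^ 2 = 1 - θ) (m : ℕ) :
    (-θ) ^ (m + 1) = Nat.fib m - Nat.fib (m + 1) * θ := by
  induction m with
  | zero => simp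
  | succ m ih =>
    rw [pow_succ, ih, Nat.fib_add_two]
    push_cast
    linear_combination (Nat.fib (m + 1) : ℝ) * hθ

theorem fib_cassini (m : ℕ) :
    (Nat.fib (m + 1) : ℤ) ^ 2 - Nat.fib (m + 1) * Nat.fib m - (Nat.fib m : ℤ) ^ 2 =
      (-1) ^ m := by
  induction m with
  | zero => simp
  | succ m ih =>
    rw [pow_succ (-1 : ℤ), ← ih, Nat.fib_add_two]
    push_cast
    ring

theorem sturmian_of_succ_eq {θ : ℝ} {i m : ℕ} (h : i + 1 = m) :
    sturmian θ i = ⌊(m : ℝ) * θ + θ⌋ - ⌊(m : ℝ) * θ⌋ := by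
  subst h
  unfold sturmian
  push_cast
  congr 2
  ring

/-- A lower bound for the return times of the rotation by `(2θ + 1) X`, where
`X = f - e θ` is a unit, to a one-sided neighbourhood of `0`. -/
theorem return_time_lower_bound {θ X : ℝ} {e f u M : ℤ} (hθ : θ ^ 2 = 1 - θ) (hθ0 : 0 < θ)
    (he : 0 < e) (hf : 0 < f) (hef : f ^ 2 + e * f - e ^ 2 = 1) (hX : X = f - e * θ)
    (hX0 : 0 < X) (hu : 1 ≤ u) (hlow : -X ^ 2 < u * ((2 * θ + 1) * X) - M)
    (hupp : u * ((2 * θ + 1) * X) - M < θ * X) :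
    e ^ 2 + (e + f) ^ 2 - (e + f) ≤ u := by
  have hefR : (f : ℝ) ^ 2 + e * f - e ^ 2 = 1 := by exact_mod_cast hef
  have heR : (0 : ℝ) < e := by exact_mod_cast he
  have hfR : (0 : ℝ) < f := by exact_mod_cast hf
  have hY : X * (f + e * θ + e) = 1 := by
    rw [hX]
    linear_combination hefR - (e : ℝ) ^ 2 * hθ
  obtain ⟨w, hw⟩ : ∃ w : ℤ, u = w + M * e := ⟨u - M * e, by ring⟩
  have hwR : (u : ℝ) = w + M * e := by exact_mod_cast hw
  have hval : (u : ℝ) * ((2 * θ + 1) * X) - M = w * ((2 * θ + 1) * X) - M * X ^ 2 := by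
    rw [hwR]
    linear_combination (M : ℝ) * hY + (M * X : ℝ) * hX
  rw [hval] at hlow hupp
  have hδ : 0 < (2 * θ + 1) * X := by positivity
  rcases le_or_gt w 0 with h | h
  · exfalso
    have h1 : (w : ℝ) ≤ 0 := by exact_mod_cast h
    have h2 : (w : ℝ) * ((2 * θ + 1) * X) ≤ 0 := mul_nonpos_of_nonpos_of_nonneg h1 hδ.le
    have h3 : (M : ℝ) < 1 := by
      by_contra! h4
      nlinarith [mul_le_mul_of_nonneg_right h4 (sq_nonneg X)]
    have h5 : M < 1 := by exact_mod_cast h3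
    nlinarith
  · have h1 : (1 : ℝ) ≤ w := by exact_mod_cast h
    have h2 : (2 * θ + 1) * X ≤ w * ((2 * θ + 1) * X) := le_mul_of_one_le_left hδ.le h1
    have h3 : 1 + θ < M * X := by
      by_contra! h4
      nlinarith [mul_le_mul_of_nonneg_right h4 hX0.le]
    have h4 : (1 + θ) * (f + e * θ + e) < M := by
      have h5 : 0 < f + e * θ + e := by positivity
      calc (1 + θ) * (f + e * θ + e) < M * X * (f + e * θ + e) := by gcongr
        _ = M := by rw [mul_assoc, hY, mul_one]
    have h6 : (e : ℝ) * ((1 + θ) * (f + e * θ + e)) < e * M := by gcongr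
    have h7 : 0 < (e : ℝ) * θ * X := by positivity
    have h8 : ((e ^ 2 + (e + f) ^ 2 - (e + f) : ℤ) : ℝ) + e * θ * X + e + f =
        1 + e * ((1 + θ) * (f + e * θ + e)) := by
      push_cast
      rw [hX]
      linear_combination hefR - 2 * (e : ℝ) ^ 2 * hθ
    have h9 : ((e ^ 2 + (e + f) ^ 2 - (e + f) : ℤ) : ℝ) ≤ u := by
      rw [hwR]
      linarith
    exact_mod_cast h9

/-- The value of the rotation by `(2θ + 1) X` at the time `e² + (e + f)² - (e + f)`. -/
theorem rotation_at_critical_time {θ X e f : ℝ} (hθ : θ ^ 2 = 1 - θ)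
    (hef : f ^ 2 + e * f - e ^ 2 = 1) (hX : X = f - e * θ) :
    ((e + 2 * f) * (e ^ 2 + (e + f) ^ 2 - (e + f)) + 1) * θ =
      e * (e + 2 * f) * (e + f) + (e ^ 2 + f ^ 2) * e + e - e * (e + 2 * f) +
        θ * (X - X ^ 2 + X ^ 3) := by
  have h2 : X ^ 2 = e ^ 2 + f ^ 2 - (2 * e * f + e ^ 2) * θ := by
    rw [hX]
    linear_combination e ^ 2 * hθ
  have h3 : X ^ 3 = (e ^ 2 + f ^ 2) * f + (2 * e * f + e ^ 2) * e
      - ((e ^ 2 + f ^ 2) * e + (2 * e * f + e ^ 2) * f + (2 * e * f + e ^ 2) * e) * θ := by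
    rw [pow_succ, h2, hX]
    linear_combination (2 * e * f + e ^ 2) * e * hθ
  rw [h2, h3, hX]
  grind

/-- **Theorem 10 (lower bound on diversity).**  Let `s` be the characteristic Sturmian
sequence of slope `θ = (√5-1)/2`, and for `n ≥ 2` set `r = L_{2n}`, `a = F_{2n-1} - 1`,
`b = L_{2n} - 1`.  Then `s_{rk+a} = s_{rk+b}` for `0 ≤ k ≤ F_{4n+1} - F_{2n+1} - 2`, but
`s_{rk+a} = 0 ≠ 1 = s_{rk+b}` for `k = F_{4n+1} - F_{2n+1} - 1`. -/
theorem sturmian_diversity_lower_bound (n : ℕ) (hn : 2 ≤ n) :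
    (∀ k : ℕ, k ≤ Nat.fib (4 * n + 1) - Nat.fib (2 * n + 1) - 2 →
      sturmian ((Real.sqrt 5 - 1) / 2) (lucas (2 * n) * k + (Nat.fib (2 * n - 1) - 1)) =
        sturmian ((Real.sqrt 5 - 1) / 2) (lucas (2 * n) * k + (lucas (2 * n) - 1))) ∧
    (sturmian ((Real.sqrt 5 - 1) / 2)
        (lucas (2 * n) * (Nat.fib (4 * n + 1) - Nat.fib (2 * n + 1) - 1) +
          (Nat.fib (2 * n - 1) - 1)) = 0 ∧
      sturmian ((Real.sqrt 5 - 1) / 2)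
        (lucas (2 * n) * (Nat.fib (4 * n + 1) - Nat.fib (2 * n + 1) - 1) +
          (lucas (2 * n) - 1)) = 1) := by
  have hs : Real.sqrt 5 ^ 2 = 5 := Real.sq_sqrt (by norm_num)
  have hs2 : 2 < Real.sqrt 5 := Real.lt_sqrt_of_sq_lt (by norm_num)
  have hs3 : Real.sqrt 5 < 7 / 3 := by nlinarith
  obtain ⟨θ, hθdef⟩ : ∃ θ, θ = (Real.sqrt 5 - 1) / 2 := ⟨_, rfl⟩
  rw [← hθdef]
  have hθ : θ ^ 2 = 1 - θ := by
    rw [hθdef]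
    linear_combination hs / 4
  have hθ0 : 1 / 2 < θ := by linarith
  have hθ1 : θ < 2 / 3 := by linarith
  clear hs hs2 hs3 hθdef
  obtain ⟨m, hm⟩ : ∃ m, 2 * n = m + 1 := ⟨2 * n - 1, by omega⟩
  have hm3 : 3 ≤ m := by omega
  have hodd : Odd m := ⟨n - 1, by omega⟩
  have hX := neg_pow_succ_eq_fib_sub_fib_mul hθ m
  have hcas := fib_cassini m
  rw [hodd.neg_one_pow] at hcas
  rw [show 4 * n + 1 = 2 * (m + 1) + 1 by omega, hm, Nat.fib_two_mul_add_one,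
    lucas_succ_eq_fib_add_fib, Nat.fib_add_two, Nat.add_sub_cancel]
  rw [← hm, (even_two_mul n).neg_pow, hm] at hX
  have hf : 2 ≤ Nat.fib m := Nat.fib_mono hm3
  have he : 3 ≤ Nat.fib (m + 1) := Nat.fib_mono (show 4 ≤ m + 1 by omega)
  have hX0 : 0 < θ ^ (m + 1) := by positivity
  have hX1 : θ ^ (m + 1) < 1 / 2 := by
    have h1 : θ ^ (m + 1) ≤ θ ^ 2 := pow_le_pow_of_le_one (by linarith) (by linarith) (by omega)
    linarith
  generalize θ ^ (m + 1) = X at hX hX0 hX1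
  generalize Nat.fib (m + 1) = e at *
  generalize Nat.fib m = f at *
  clear hm hm3 hodd hn m n
  have hef : (f : ℤ) ^ 2 + e * f - (e : ℤ) ^ 2 = 1 := by linarith
  have hefR : (f : ℝ) ^ 2 + e * f - (e : ℝ) ^ 2 = 1 := by exact_mod_cast hef
  obtain ⟨T, hT⟩ : ∃ T, T = (f + e) ^ 2 + e ^ 2 - (f + e) := ⟨_, rfl⟩
  have hTadd : T + (f + e) = (f + e) ^ 2 + e ^ 2 := by
    rw [hT]
    exact Nat.sub_add_cancel (by nlinarith)
  have hT2 : 2 ≤ T := by nlinarith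
  rw [← hT]
  have hTZ : (T : ℤ) = e ^ 2 + (e + f) ^ 2 - (e + f) := by
    have : (T : ℤ) + (f + e) = (f + e) ^ 2 + e ^ 2 := by exact_mod_cast hTadd
    linarith
  have hTR : (T : ℝ) = e ^ 2 + (e + f) ^ 2 - (e + f) := by exact_mod_cast hTZ
  have hcrit := rotation_at_critical_time hθ hefR hX
  rw [← hTR] at hcrit
  obtain ⟨P, hP⟩ : ∃ P : ℤ, (P : ℝ) = e * (e + 2 * f) * (e + f) + (e ^ 2 + f ^ 2) * e + e -
      e * (e + 2 * f) := ⟨e * (e + 2 * f) * (e + f) + (e ^ 2 + f ^ 2) * e + e -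
      e * (e + 2 * f), by push_cast; ring⟩
  rw [← hP] at hcrit
  have hbound : ∀ (t : ℕ) (M : ℤ), 1 ≤ t → -X ^ 2 < t * ((2 * θ + 1) * X) - M →
      t * ((2 * θ + 1) * X) - M < θ * X → T ≤ t := by
    intro t M ht h1 h2
    have := return_time_lower_bound (e := e) (f := f) (u := t) (M := M) hθ (by linarith)
      (by omega) (by omega) hef (by exact_mod_cast hX) hX0 (by exact_mod_cast ht)
      (by exact_mod_cast h1) (by exact_mod_cast h2)
    rw [← hTZ] at this
    exact_mod_cast this
  have hrot : ((e : ℝ) + 2 * f) * θ = (2 * e - f) + (2 * θ + 1) * X := by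
    rw [hX]
    linear_combination 2 * (e : ℝ) * hθ
  have hgap : ∀ k : ℕ, (((f + (f + e)) * (k + 1) : ℕ) : ℝ) * θ =
      (((f + (f + e)) * k + f : ℕ) : ℝ) * θ + e + θ * X := by
    intro k
    push_cast
    rw [hX]
    linear_combination (e : ℝ) * hθ
  have hpow2 : 0 < X ^ 2 := by positivity
  have hpow3 : 0 < X ^ 3 := by positivity
  have hpow32 : X ^ 3 < X ^ 2 := by nlinarith
  have hpow21 : X ^ 2 < 1 / 2 * X := by nlinarith
  have hθX : 0 < θ * X := by positivity
  have hθpow : 0 < θ * (X ^ 2 - X ^ 3) := by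
    apply mul_pos <;> linarith
  have hθpow' : θ * (X ^ 2 - X ^ 3) < X ^ 2 := by
    have h1 : θ * (X ^ 2 - X ^ 3) < 1 * (X ^ 2 - X ^ 3) := by
      apply mul_lt_mul_of_pos_right <;> linarith
    linarith
  have hsa : ∀ k, sturmian θ ((f + (f + e)) * k + (f - 1)) = _ := fun k =>
    sturmian_of_succ_eq (m := (f + (f + e)) * k + f) (by omega)
  have hsb : ∀ k, sturmian θ ((f + (f + e)) * k + (f + (f + e) - 1)) = _ := fun k =>
    sturmian_of_succ_eq (m := (f + (f + e)) * (k + 1)) (by rw [mul_add, mul_one]; omega)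
  refine ⟨fun k hk => ?_, ?_⟩
  · rw [hsa, hsb]
    have htT : ¬ T ≤ k + 1 := by omega
    have hstep : ∀ y z : ℝ, z = y + e + θ * X → θ * X ≤ z - ⌊z⌋ → ⌊z⌋ = ⌊y⌋ + e := by
      intro y z hz h
      have h1 := Int.lt_floor_add_one z
      have h2 : ⌊y⌋ = ⌊z⌋ - e := by
        rw [Int.floor_eq_iff]
        push_cast
        constructor <;> linarith
      rw [h2]
      ring
    have htδ : (((f + (f + e)) * (k + 1) : ℕ) : ℝ) * θ =
        (k + 1) * (2 * e - f) + ((k + 1 : ℕ) : ℝ) * ((2 * θ + 1) * X) := by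
      push_cast
      linear_combination ((k : ℝ) + 1) * hrot
    have hg := hgap k
    generalize (((f + (f + e)) * (k + 1) : ℕ) : ℝ) * θ = z at *
    generalize (((f + (f + e)) * k + f : ℕ) : ℝ) * θ = y at *
    rw [hstep y z hg, hstep (y + θ) (z + θ) (by linarith)]
    · ring
    · by_contra! h
      have h1 := Int.floor_le (z + θ)
      obtain ⟨u, hu⟩ : ∃ u, T = u + (k + 1) := ⟨T - (k + 1), by omega⟩
      have huR : (T : ℝ) = u + (k + 1) := by exact_mod_cast hu
      have hk1 : (k : ℤ) + 1 = ((k + 1 : ℕ) : ℤ) := by norm_cast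
      have key : (u : ℝ) * ((2 * θ + 1) * X) -
          ((P - ⌊z + θ⌋ - u * (2 * e - f) : ℤ) : ℝ) =
            θ * (X - X ^ 2 + X ^ 3) - (z + θ - ⌊z + θ⌋) := by
        rw [huR] at hcrit
        push_cast at htδ ⊢
        linear_combination hcrit + htδ - ((u : ℝ) + (k + 1)) * hrot
      have := hbound u _ (by omega) (by rw [key]; linarith) (by rw [key]; linarith)
      omega
    · by_contra! h
      have h1 := Int.floor_le z
      have key : ((k + 1 : ℕ) : ℝ) * ((2 * θ + 1) * X) -
          ((⌊z⌋ - (k + 1) * (2 * e - f) : ℤ) : ℝ) = z - ⌊z⌋ := by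
        push_cast at htδ ⊢
        linear_combination -htδ
      exact htT (hbound (k + 1) _ (by omega) (by rw [key]; linarith) (by rw [key]; linarith))
  · rw [hsa, hsb]
    have hg := hgap (T - 1)
    rw [Nat.sub_add_cancel (by omega)] at hg ⊢
    have hz : (((f + (f + e)) * T : ℕ) : ℝ) * θ + θ = P + θ * (X - X ^ 2 + X ^ 3) := by
      push_cast
      linear_combination hcrit
    generalize (((f + (f + e)) * T : ℕ) : ℝ) * θ = z at *
    generalize (((f + (f + e)) * (T - 1) + f : ℕ) : ℝ) * θ = y at *
    have b1 : 0 < θ * (X - X ^ 2 + X ^ 3) := by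
      apply mul_pos <;> linarith
    have b2 : θ * (X - X ^ 2 + X ^ 3) < θ * 1 := by
      apply mul_lt_mul_of_pos_left <;> linarith
    have f1 : ⌊z + θ⌋ = P := by
      rw [Int.floor_eq_iff]
      constructor <;> linarith
    have f2 : ⌊z⌋ = P - 1 := by
      rw [Int.floor_eq_iff]
      push_cast
      constructor <;> linarith
    have f3 : ⌊y + θ⌋ = P - e - 1 := by
      rw [Int.floor_eq_iff]
      push_cast
      constructor <;> linarith
    have f4 : ⌊y⌋ = P - e - 1 := by
      rw [Int.floor_eq_iff]
      push_cast
      constructor <;> linarith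
    rw [f1, f2, f3, f4]
    constructor <;> ring
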